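/- In the general (not necessarily convex) case, fix j ∈ {1,…,m} and let u^{+,d} (resp. u^{−,d}) be optimal solutions of the order-d inf-relaxations of the second step with data the moments of φ_j⁺ (resp. φ_j⁻), i.e. minimizing u_{0,1} subject to u_{α,0} = ∫ x^α dφ_j^± for |α| ≤ 2d, M_d(u) ⪰ 0, M_{d−ℓ_j}(θ_j·u) = 0, M_{d−1}(z·u) ⪰ 0 and M_{d−1}((τ−z²)·u) ⪰ 0. Then lim_{d→∞} (u^{+,d}_{α,1} + u^{−,d}_{α,1}) = ∫_{Ω_j} x^α dσ_j for all α ∈ ℕⁿ, and u^{+,d}_{0,1} + u^{−,d}_{0,1} ↑ σ_j(Ω_j) as d → ∞; if instead u^{±,d} are optimal solutions of the corresponding sup-relaxations, then again lim_{d→∞} (u^{+,d}_{α,1} + u^{−,d}_{α,1}) = ∫_{Ω_j} x^α dσ_j for all α ∈ ℕⁿ, and u^{+,d}_{0,1} + u^{−,d}_{0,1} ↓ σ_j(Ω_j) as d → ∞. -/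

import Mathlib

open MeasureTheory MvPolynomial Filter Topology
open scoped ENNReal

noncomputable section

/-- the monomial `x^α` -/
def monom {n : ℕ} (α : Fin n → ℕ) (x : EuclideanSpace ℝ (Fin n)) : ℝ := ∏ i, x i ^ α i

/-- `|α| = α₁ + ⋯ + αₙ` -/
def degSum {n : ℕ} (α : Fin n → ℕ) : ℕ := ∑ i, α i

/-- evaluation of a polynomial at a point of Euclidean space -/
def pev {n : ℕ} (p : MvPolynomial (Fin n) ℝ) (x : EuclideanSpace ℝ (Fin n)) : ℝ :=
  eval (fun i => x i) p

/-- the Riesz functional `L_y` of a multisequence `y` -/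
def riesz {n : ℕ} (y : (Fin n → ℕ) → ℝ) (p : MvPolynomial (Fin n) ℝ) : ℝ :=
  ∑ m ∈ p.support, p.coeff m * y (fun i => m i)

/-- positive semidefiniteness of the localizing matrix `M(g·y)` with rows and columns
indexed by monomials of degree `≤ k` (equivalent quadratic-form formulation:
`0 ≤ L_y(g·p²)` for every polynomial `p` of degree `≤ k`). -/
def locPSD {n : ℕ} (y : (Fin n → ℕ) → ℝ) (g : MvPolynomial (Fin n) ℝ) (k : ℕ) : Prop :=
  ∀ p : MvPolynomial (Fin n) ℝ, p.totalDegree ≤ k → 0 ≤ riesz y (g * p ^ 2)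

/-- the localizing matrix `M(g·y)` with rows/columns of degree `≤ k` vanishes
(entrywise, extended bilinearly). -/
def locZero {n : ℕ} (y : (Fin n → ℕ) → ℝ) (g : MvPolynomial (Fin n) ℝ) (k : ℕ) : Prop :=
  ∀ p q : MvPolynomial (Fin n) ℝ, p.totalDegree ≤ k → q.totalDegree ≤ k →
    riesz y (g * (p * q)) = 0

/-- a Borel measure `μ` represents the multisequence `y` if all monomials are
`μ`-integrable with `∫ x^α dμ = y_α`. -/
def Represents {n : ℕ} (μ : Measure (EuclideanSpace ℝ (Fin n))) (y : (Fin n → ℕ) → ℝ) : Prop :=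
  ∀ α : Fin n → ℕ, Integrable (monom α) μ ∧ ∫ x, monom α x ∂μ = y α

/-- `‖∇g(x)‖²` -/
def gradSq {n : ℕ} (p : MvPolynomial (Fin n) ℝ) (x : EuclideanSpace ℝ (Fin n)) : ℝ :=
  ∑ i, (pev (pderiv i p) x) ^ 2

/-- `‖∇g(x)‖` -/
def gradNorm {n : ℕ} (p : MvPolynomial (Fin n) ℝ) (x : EuclideanSpace ℝ (Fin n)) : ℝ :=
  Real.sqrt (gradSq p x)

/-- `q(x) = ⟨x, ∇g(x)⟩` -/
def xGrad {n : ℕ} (p : MvPolynomial (Fin n) ℝ) (x : EuclideanSpace ℝ (Fin n)) : ℝ :=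
  ∑ i, x i * pev (pderiv i p) x

/-- the basic closed semi-algebraic set `Ω = {x | g_j(x) ≤ b_j, j = 1,…,m}` -/
def Om {n m : ℕ} (g : Fin m → MvPolynomial (Fin n) ℝ) (b : Fin m → ℝ) :
    Set (EuclideanSpace ℝ (Fin n)) :=
  {x | ∀ j, pev (g j) x ≤ b j}

/-- `Ω_j = {x ∈ Ω | g_j(x) = b_j}` -/
def OmJ {n m : ℕ} (g : Fin m → MvPolynomial (Fin n) ℝ) (b : Fin m → ℝ) (j : Fin m) :
    Set (EuclideanSpace ℝ (Fin n)) :=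
  {x | x ∈ Om g b ∧ pev (g j) x = b j}

/-- the open box `B = (−1,1)ⁿ` -/
def Box (n : ℕ) : Set (EuclideanSpace ℝ (Fin n)) := {x | ∀ i, |x i| < 1}

/-- the `(n−1)`-dimensional Hausdorff measure on `ℝⁿ` -/
def hsd (n : ℕ) : Measure (EuclideanSpace ℝ (Fin n)) := μH[(n : ℝ) - 1]

/-- `σ_j`: the restriction to `Ω_j` of the `(n−1)`-dimensional Hausdorff measure -/
def sigmaJ {n m : ℕ} (g : Fin m → MvPolynomial (Fin n) ℝ) (b : Fin m → ℝ) (j : Fin m) :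
    Measure (EuclideanSpace ℝ (Fin n)) :=
  (hsd n).restrict (OmJ g b j)

/-- `φ_j`: the measure `dφ_j = ‖∇g_j‖⁻¹ dσ_j` on `Ω_j` -/
def phiJ {n m : ℕ} (g : Fin m → MvPolynomial (Fin n) ℝ) (b : Fin m → ℝ) (j : Fin m) :
    Measure (EuclideanSpace ℝ (Fin n)) :=
  (sigmaJ g b j).withDensity fun x => ENNReal.ofReal (gradNorm (g j) x)⁻¹


/-- lift a polynomial in `x` to a polynomial in `(x, z)` -/
def liftP {n : ℕ} (p : MvPolynomial (Fin n) ℝ) : MvPolynomial (Fin (n + 1)) ℝ :=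
  rename Fin.castSucc p

/-- the variable `z` -/
def zP (n : ℕ) : MvPolynomial (Fin (n + 1)) ℝ := X (Fin.last n)

/-- `θ(x,z) = z² − ‖∇g(x)‖²` as a polynomial in `(x, z)` -/
def thetaP {n : ℕ} (p : MvPolynomial (Fin n) ℝ) : MvPolynomial (Fin (n + 1)) ℝ :=
  zP n ^ 2 - ∑ i : Fin n, liftP (pderiv i p) ^ 2

/-- the multi-index `(α, k) ∈ ℕ^{n+1}` -/
def idxZ {n : ℕ} (α : Fin n → ℕ) (k : ℕ) : Fin (n + 1) → ℕ := Fin.snoc α k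

/-- the moments `v_{j,α} = ∫_{Ω_j} x^α dφ_j` of `φ_j` -/
def phiMom {n m : ℕ} (g : Fin m → MvPolynomial (Fin n) ℝ) (b : Fin m → ℝ) (j : Fin m)
    (α : Fin n → ℕ) : ℝ := ∫ x, monom α x ∂(phiJ g b j)

/-- feasibility for the order-`d` second-step semidefinite program
\eqref{second-step}/\eqref{second-step-inf}, with data `v` (the moments of `φ_j`),
over finite sequences `u = (u_{α,k})_{|(α,k)|≤2d}`: `u_{α,0} = v_α` for `|α| ≤ 2d`,
`M_d(u) ⪰ 0`, `M_{d−ℓ}(θ·u) = 0`, `M_{d−1}((τ−z²)·u) ⪰ 0` and `M_{d−1}(z·u) ⪰ 0`. -/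
def FeasSDP2 {n : ℕ} (θ : MvPolynomial (Fin (n + 1)) ℝ) (τ : ℝ) (ℓ : ℕ)
    (v : (Fin n → ℕ) → ℝ) (d : ℕ) (u : (Fin (n + 1) → ℕ) → ℝ) : Prop :=
  (∀ γ : Fin (n + 1) → ℕ, 2 * d < degSum γ → u γ = 0) ∧
  (∀ α : Fin n → ℕ, degSum α ≤ 2 * d → u (idxZ α 0) = v α) ∧
  (∀ p : MvPolynomial (Fin (n + 1)) ℝ, p.totalDegree ≤ d → 0 ≤ riesz u (p ^ 2)) ∧
  locZero u θ (d - ℓ) ∧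
  locPSD u (C τ - zP n ^ 2) (d - 1) ∧
  locPSD u (zP n) (d - 1)

/-- optimality for the `sup`-version \eqref{second-step} of the second-step SDP -/
def IsMaxSDP2 {n : ℕ} (θ : MvPolynomial (Fin (n + 1)) ℝ) (τ : ℝ) (ℓ : ℕ)
    (v : (Fin n → ℕ) → ℝ) (d : ℕ) (u : (Fin (n + 1) → ℕ) → ℝ) : Prop :=
  FeasSDP2 θ τ ℓ v d u ∧
  ∀ u', FeasSDP2 θ τ ℓ v d u' → u' (idxZ (fun _ => 0) 1) ≤ u (idxZ (fun _ => 0) 1)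

/-- optimality for the `inf`-version \eqref{second-step-inf} of the second-step SDP -/
def IsMinSDP2 {n : ℕ} (θ : MvPolynomial (Fin (n + 1)) ℝ) (τ : ℝ) (ℓ : ℕ)
    (v : (Fin n → ℕ) → ℝ) (d : ℕ) (u : (Fin (n + 1) → ℕ) → ℝ) : Prop :=
  FeasSDP2 θ τ ℓ v d u ∧
  ∀ u', FeasSDP2 θ τ ℓ v d u' → u (idxZ (fun _ => 0) 1) ≤ u' (idxZ (fun _ => 0) 1)

/-- `Ω_j⁺ = {x ∈ Ω_j : q_j(x) ≥ 0}` -/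
def OmJp {n m : ℕ} (g : Fin m → MvPolynomial (Fin n) ℝ) (b : Fin m → ℝ) (j : Fin m) :
    Set (EuclideanSpace ℝ (Fin n)) :=
  {x | x ∈ OmJ g b j ∧ 0 ≤ xGrad (g j) x}

/-- `Ω_j⁻ = {x ∈ Ω_j : q_j(x) < 0}` -/
def OmJm {n m : ℕ} (g : Fin m → MvPolynomial (Fin n) ℝ) (b : Fin m → ℝ) (j : Fin m) :
    Set (EuclideanSpace ℝ (Fin n)) :=
  {x | x ∈ OmJ g b j ∧ xGrad (g j) x < 0}

/-- `φ_j⁺`: the restriction of `φ_j` to `Ω_j⁺` -/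
def phiJp {n m : ℕ} (g : Fin m → MvPolynomial (Fin n) ℝ) (b : Fin m → ℝ) (j : Fin m) :
    Measure (EuclideanSpace ℝ (Fin n)) :=
  (phiJ g b j).restrict (OmJp g b j)

/-- `φ_j⁻`: the restriction of `φ_j` to `Ω_j⁻` -/
def phiJm {n m : ℕ} (g : Fin m → MvPolynomial (Fin n) ℝ) (b : Fin m → ℝ) (j : Fin m) :
    Measure (EuclideanSpace ℝ (Fin n)) :=
  (phiJ g b j).restrict (OmJm g b j)

/-- the moments of `φ_j⁺` -/
def phiMomP {n m : ℕ} (g : Fin m → MvPolynomial (Fin n) ℝ) (b : Fin m → ℝ) (j : Fin m)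
    (α : Fin n → ℕ) : ℝ := ∫ x, monom α x ∂(phiJp g b j)

/-- the moments of `φ_j⁻` -/
def phiMomM {n m : ℕ} (g : Fin m → MvPolynomial (Fin n) ℝ) (b : Fin m → ℝ) (j : Fin m)
    (α : Fin n → ℕ) : ℝ := ∫ x, monom α x ∂(phiJm g b j)


/-! ### Part 1: the level set has finite Hausdorff measure -/

theorem pev_continuous {n : ℕ} (p : MvPolynomial (Fin n) ℝ) : Continuous (pev p) := by
  unfold pev
  exact (MvPolynomial.continuous_eval p).comp (by fun_prop)

theorem pev_hasStrict {n : ℕ} (p : MvPolynomial (Fin n) ℝ) (x : EuclideanSpace ℝ (Fin n)) :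
    HasStrictFDerivAt (pev p)
      (∑ i, pev (pderiv i p) x • (EuclideanSpace.proj i : EuclideanSpace ℝ (Fin n) →L[ℝ] ℝ)) x := by
  induction p using MvPolynomial.induction_on with
  | C a =>
    have h1 : pev (C a : MvPolynomial (Fin n) ℝ) = fun _ => a := by
      funext y; simp [pev]
    rw [h1]
    convert hasStrictFDerivAt_const (𝕜 := ℝ) a x
    simp [pev]
  | add p q hp hq =>
    have h1 : pev (p + q) = fun y => pev p y + pev q y := by
      funext y; simp [pev]
    rw [h1]
    refine (hp.add hq).congr_fderiv ?_
    symm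
    rw [← Finset.sum_add_distrib]
    refine Finset.sum_congr rfl fun i _ => ?_
    rw [← add_smul]
    simp [pev]
  | mul_X p k hp =>
    have h1 : pev (p * X k) = fun y => pev p y * (EuclideanSpace.proj k : EuclideanSpace ℝ (Fin n) →L[ℝ] ℝ) y := by
      funext y; simp [pev]
    rw [h1]
    refine (hp.mul (EuclideanSpace.proj k : EuclideanSpace ℝ (Fin n) →L[ℝ] ℝ).hasStrictFDerivAt).congr_fderiv ?_
    symm
    ext v
    simp [pev, Derivation.leibniz, pderiv_X, Pi.single_apply, add_mul, Finset.sum_add_distrib,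
      Finset.mul_sum]
    congr 1
    · rw [Finset.sum_eq_single k]
      · simp
      · intro b _ hb
        simp [hb.symm]
      · simp
    · exact Finset.sum_congr rfl fun i _ => by ring

set_option maxHeartbeats 400000 in
theorem level_finite_nhds {k : ℕ} (p : MvPolynomial (Fin (k+1)) ℝ) (b : ℝ)
    (x : EuclideanSpace ℝ (Fin (k+1))) (i : Fin (k+1)) (hi : pev (pderiv i p) x ≠ 0) :
    ∃ s ∈ 𝓝 x, μH[(k : ℝ)] (s ∩ {y | pev p y = b}) < ⊤ := by
  set c : ℝ := |pev (pderiv i p) x| with hc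
  have hcpos : 0 < c := abs_pos.mpr hi
  have hcc : (0 : NNReal) < Real.toNNReal (c / 2) := Real.toNNReal_pos.mpr (by positivity)
  have hcc2 : ((Real.toNNReal (c / 2) : NNReal) : ℝ) = c / 2 := Real.coe_toNNReal _ (by positivity)
  obtain ⟨s, hs, hA⟩ := (pev_hasStrict p x).approximates_deriv_on_nhds (Or.inr hcc)
  -- the projection forgetting coordinate i
  let π : EuclideanSpace ℝ (Fin (k+1)) → (Fin k → ℝ) := fun y l => y (i.succAbove l)
  refine ⟨s ∩ Metric.closedBall x 1, Filter.inter_mem hs (Metric.closedBall_mem_nhds x one_pos), ?_⟩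
  set S := (s ∩ Metric.closedBall x 1) ∩ {y | pev p y = b} with hS
  set D : ℝ := ∑ l, |pev (pderiv l p) x| with hD
  have hDn : 0 ≤ D := Finset.sum_nonneg fun _ _ => abs_nonneg _
  -- key bound
  have key : ∀ y ∈ S, ∀ z ∈ S, dist y z ≤ ((k + 1 + 2 * D / c + k)) * 2 * dist (π y) (π z) := by
    intro y hy z hz
    have h1 := hA y hy.1.1 z hz.1.1
    have hyb : pev p y = b := hy.2
    have hzb : pev p z = b := hz.2
    rw [hyb, hzb] at h1
    set w := y - z with hw
    have hwl : ∀ l, |w (i.succAbove l)| ≤ dist (π y) (π z) := by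
      intro l
      have := dist_le_pi_dist (π y) (π z) l
      rw [Real.dist_eq] at this
      simpa [π, hw] using this
    set t := dist (π y) (π z) with ht
    have ht0 : 0 ≤ t := dist_nonneg
    have hnw : ‖w‖ ≤ |w i| + k * t := by
      have h2 : ‖w‖ ≤ ∑ l, |w l| := by
        rw [EuclideanSpace.norm_eq]
        apply Real.sqrt_le_iff.mpr
        refine ⟨Finset.sum_nonneg fun _ _ => abs_nonneg _, ?_⟩
        have := Finset.sum_sq_le_sq_sum_of_nonneg (s := Finset.univ) (f := fun l => |w l|)
          (fun _ _ => abs_nonneg _)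
        simpa using this
      rw [Fin.sum_univ_succAbove _ i] at h2
      have h3 : ∑ l : Fin k, |w (i.succAbove l)| ≤ k * t := by
        calc _ ≤ ∑ l : Fin k, t := Finset.sum_le_sum fun l _ => hwl l
          _ = _ := by simp
      linarith
    have h4 : |∑ l, pev (pderiv l p) x * w l| ≤ c / 2 * ‖w‖ := by
      have h5 : (∑ l, pev (pderiv l p) x • (EuclideanSpace.proj l : EuclideanSpace ℝ (Fin (k+1)) →L[ℝ] ℝ)) w
          = ∑ l, pev (pderiv l p) x * w l := by
        simp
      rw [h5, hcc2, sub_self, zero_sub, norm_neg, Real.norm_eq_abs] at h1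
      exact h1
    rw [Fin.sum_univ_succAbove _ i] at h4
    have h6 : |∑ l : Fin k, pev (pderiv (i.succAbove l) p) x * w (i.succAbove l)| ≤ D * t := by
      calc _ ≤ ∑ l : Fin k, |pev (pderiv (i.succAbove l) p) x * w (i.succAbove l)| :=
            Finset.abs_sum_le_sum_abs _ _
        _ ≤ ∑ l : Fin k, |pev (pderiv (i.succAbove l) p) x| * t := by
            refine Finset.sum_le_sum fun l _ => ?_
            rw [abs_mul]
            exact mul_le_mul_of_nonneg_left (hwl l) (abs_nonneg _)
        _ = (∑ l : Fin k, |pev (pderiv (i.succAbove l) p) x|) * t := by rw [Finset.sum_mul]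
        _ ≤ D * t := by
            refine mul_le_mul_of_nonneg_right ?_ ht0
            rw [hD, Fin.sum_univ_succAbove _ i]
            linarith [abs_nonneg (pev (pderiv i p) x)]
    have h7 : c * |w i| ≤ c / 2 * ‖w‖ + D * t := by
      rw [hc, ← abs_mul, ← hc]
      have := abs_sub_abs_le_abs_sub (pev (pderiv i p) x * w i)
        (-(∑ l : Fin k, pev (pderiv (i.succAbove l) p) x * w (i.succAbove l)))
      rw [sub_neg_eq_add, abs_neg] at this
      linarith
    have h8 : |w i| ≤ ‖w‖ / 2 + D / c * t := by
      have : c * |w i| ≤ c * (‖w‖ / 2 + D / c * t) := by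
        have : c * (‖w‖ / 2 + D / c * t) = c / 2 * ‖w‖ + D * t := by field_simp
        linarith
      exact le_of_mul_le_mul_left this hcpos
    have h9 : ‖w‖ ≤ 2 * (D / c + k) * t := by
      have e1 : 2 * (D / c + k) * t = 2 * (D / c * t) + 2 * (k * t) := by ring
      linarith
    rw [dist_eq_norm]
    refine h9.trans ?_
    refine mul_le_mul_of_nonneg_right ?_ ht0
    have : 0 ≤ D / c := div_nonneg hDn hcpos.le
    have h10 : 2 * D / c = 2 * (D / c) := by ring
    rw [h10]
    have : (0:ℝ) ≤ k := Nat.cast_nonneg k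
    linarith
  set Kc : ℝ := ((k + 1 + 2 * D / c + k)) * 2 with hKc
  have hK0 : 0 ≤ Kc := by
    have h1 : 0 ≤ 2 * D / c := div_nonneg (mul_nonneg zero_le_two hDn) hcpos.le
    have h2 : (0:ℝ) ≤ k := Nat.cast_nonneg k
    rw [hKc]
    linarith
  clear_value Kc
  have hanti : AntilipschitzWith (Real.toNNReal Kc) (fun y : S => π y) := by
    apply AntilipschitzWith.of_le_mul_dist
    intro y z
    rw [Real.coe_toNNReal _ hK0]
    exact key y y.2 z z.2
  have hfin := hanti.le_hausdorffMeasure_image (d := (k : ℝ)) (by positivity) Set.univ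
  have hiso : μH[(k : ℝ)] ((Subtype.val : S → EuclideanSpace ℝ (Fin (k+1))) '' Set.univ)
      = μH[(k : ℝ)] (Set.univ : Set S) :=
    (isometry_subtype_coe).hausdorffMeasure_image (Or.inl (by positivity)) _
  rw [Set.image_univ, Subtype.range_coe] at hiso
  rw [hiso]
  refine lt_of_le_of_lt hfin ?_
  refine ENNReal.mul_lt_top (ENNReal.rpow_lt_top_of_nonneg (by positivity) ENNReal.coe_ne_top) ?_
  have hvol : (μH[(k : ℝ)] : Measure (Fin k → ℝ)) = volume := by
    have := hausdorffMeasure_pi_real (ι := Fin k)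
    simpa using this
  rw [hvol]
  refine lt_of_le_of_lt (measure_mono (t := Metric.closedBall (π x) 1) ?_) measure_closedBall_lt_top
  rintro _ ⟨y, -, rfl⟩
  rw [Metric.mem_closedBall]
  refine (dist_pi_le_iff zero_le_one).mpr fun l => ?_
  have h1 : dist y.1 x ≤ 1 := y.2.1.2
  have h2 := PiLp.norm_apply_le (y.1 - x) (i.succAbove l)
  rw [dist_eq_norm] at h1
  rw [Real.dist_eq]
  have h3 : π y.1 l - π x l = (y.1 - x) (i.succAbove l) := by simp [π]
  rw [h3, ← Real.norm_eq_abs]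
  exact h2.trans h1

theorem OmJ_isCompact {n m : ℕ} (g : Fin m → MvPolynomial (Fin n) ℝ) (b : Fin m → ℝ)
    (j : Fin m) (hcomp : IsCompact (Om g b)) : IsCompact (OmJ g b j) := by
  have : OmJ g b j = Om g b ∩ {x | pev (g j) x = b j} := rfl
  rw [this]
  exact hcomp.inter_right (isClosed_eq (pev_continuous _) continuous_const)

theorem OmJ_finite {n m : ℕ} (g : Fin m → MvPolynomial (Fin n) ℝ) (b : Fin m → ℝ)
    (j : Fin m) (hcomp : IsCompact (Om g b))
    (hgrad : ∀ x ∈ OmJ g b j, gradNorm (g j) x ≠ 0) : hsd n (OmJ g b j) < ⊤ := by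
  refine (OmJ_isCompact g b j hcomp).measure_lt_top_of_nhdsWithin fun x hx => ?_
  have h := hgrad x hx
  have : ∃ i, pev (pderiv i (g j)) x ≠ 0 := by
    by_contra hne
    push Not at hne
    exact h (by simp [gradNorm, gradSq, hne])
  obtain ⟨i, hi⟩ := this
  cases n with
  | zero => exact i.elim0
  | succ k =>
    obtain ⟨s, hs, hfin⟩ := level_finite_nhds (g j) (b j) x i hi
    refine ⟨s ∩ OmJ g b j, Filter.inter_mem (mem_nhdsWithin_of_mem_nhds hs) self_mem_nhdsWithin, ?_⟩
    have e : hsd (k+1) = μH[(k : ℝ)] := by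
      unfold hsd; push_cast; congr 1; ring
    rw [e]
    exact lt_of_le_of_lt (measure_mono (Set.inter_subset_inter_right _ fun y hy => hy.2)) hfin

/-! ### Part 2: the Riesz functional -/

theorem riesz_eq_sum {n : ℕ} (y : (Fin n → ℕ) → ℝ) (p : MvPolynomial (Fin n) ℝ)
    (s : Finset (Fin n →₀ ℕ)) (hs : p.support ⊆ s) :
    riesz y p = ∑ m ∈ s, MvPolynomial.coeff m p * y (fun i => m i) := by
  unfold riesz
  refine Finset.sum_subset hs fun m _ hm => ?_
  rw [MvPolynomial.notMem_support_iff] at hm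
  rw [show MvPolynomial.coeff m p = 0 from hm, zero_mul]

theorem riesz_add {n : ℕ} (y : (Fin n → ℕ) → ℝ) (p q : MvPolynomial (Fin n) ℝ) :
    riesz y (p + q) = riesz y p + riesz y q := by
  classical
  rw [riesz_eq_sum y (p + q) (p.support ∪ q.support) MvPolynomial.support_add,
    riesz_eq_sum y p (p.support ∪ q.support) Finset.subset_union_left,
    riesz_eq_sum y q (p.support ∪ q.support) Finset.subset_union_right,
    ← Finset.sum_add_distrib]
  refine Finset.sum_congr rfl fun m _ => ?_
  rw [MvPolynomial.coeff_add, add_mul]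

theorem riesz_C_mul {n : ℕ} (y : (Fin n → ℕ) → ℝ) (a : ℝ) (p : MvPolynomial (Fin n) ℝ) :
    riesz y (C a * p) = a * riesz y p := by
  classical
  rw [riesz_eq_sum y (C a * p) p.support, riesz, Finset.mul_sum]
  · refine Finset.sum_congr rfl fun m _ => ?_
    rw [MvPolynomial.coeff_C_mul, mul_assoc]
  · rw [← MvPolynomial.smul_eq_C_mul]
    exact MvPolynomial.support_smul

theorem riesz_monomial {n : ℕ} (y : (Fin n → ℕ) → ℝ) (m : Fin n →₀ ℕ) (a : ℝ) :
    riesz y (monomial m a) = a * y (fun i => m i) := by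
  classical
  rw [riesz_eq_sum y _ {m} MvPolynomial.support_monomial_subset]
  simp

theorem riesz_zero {n : ℕ} (y : (Fin n → ℕ) → ℝ) : riesz y 0 = 0 := by
  simp [riesz]

theorem riesz_sub {n : ℕ} (y : (Fin n → ℕ) → ℝ) (p q : MvPolynomial (Fin n) ℝ) :
    riesz y (p - q) = riesz y p - riesz y q := by
  have := riesz_add y (p - q) q
  rw [sub_add_cancel] at this
  linarith

/-- Cauchy-Schwarz for the Riesz functional. -/
theorem riesz_cs {n : ℕ} (y : (Fin n → ℕ) → ℝ) (d : ℕ)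
    (h : ∀ p : MvPolynomial (Fin n) ℝ, p.totalDegree ≤ d → 0 ≤ riesz y (p ^ 2))
    (p q : MvPolynomial (Fin n) ℝ) (hp : p.totalDegree ≤ d) (hq : q.totalDegree ≤ d) :
    riesz y (p * q) ^ 2 ≤ riesz y (p ^ 2) * riesz y (q ^ 2) := by
  have key : ∀ t : ℝ, 0 ≤ riesz y (p ^ 2) * (t * t) + (2 * riesz y (p * q)) * t + riesz y (q ^ 2) := by
    intro t
    have h1 := h (C t * p + q) ?_
    · have e : (C t * p + q) ^ 2 = C (t * t) * p ^ 2 + C (2 * t) * (p * q) + q ^ 2 := by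
        simp only [map_mul]
        rw [show (C 2 : MvPolynomial (Fin n) ℝ) = 2 from map_ofNat C 2]
        ring
      rw [e, riesz_add, riesz_add, riesz_C_mul, riesz_C_mul] at h1
      linarith
    · refine (totalDegree_add _ _).trans (max_le ?_ hq)
      refine (totalDegree_mul _ _).trans ?_
      simpa using hp
  have := discrim_le_zero key
  unfold discrim at this
  nlinarith

theorem mapDomain_castSucc {n : ℕ} (m : Fin n →₀ ℕ) :
    (fun i => (Finsupp.mapDomain Fin.castSucc m) i) = idxZ (fun i => m i) 0 := by
  funext i
  refine Fin.lastCases ?_ (fun i => ?_) i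
  · rw [Finsupp.mapDomain_of_notMem_range]
    · simp [idxZ]
    · rintro ⟨a, ha⟩
      exact (Fin.castSucc_lt_last a).ne ha
  · rw [Finsupp.mapDomain_apply (Fin.castSucc_injective n)]
    simp [idxZ]

theorem pev_monomial {n : ℕ} (m : Fin n →₀ ℕ) (a : ℝ) (x : EuclideanSpace ℝ (Fin n)) :
    pev (monomial m a) x = a * monom (fun i => m i) x := by
  unfold pev monom
  rw [eval_monomial, Finsupp.prod_fintype]
  intro i; simp

theorem monom_continuous {n : ℕ} (α : Fin n → ℕ) : Continuous (monom α) := by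
  unfold monom
  fun_prop

/-- continuous functions are integrable w.r.t. a finite measure carried by a compact set -/
theorem integ {n : ℕ} (ν : Measure (EuclideanSpace ℝ (Fin n))) [IsFiniteMeasure ν]
    (K : Set (EuclideanSpace ℝ (Fin n))) (hK : IsCompact K) (hν : ∀ᵐ x ∂ν, x ∈ K)
    (f : EuclideanSpace ℝ (Fin n) → ℝ) (hf : Continuous f) : Integrable f ν := by
  obtain ⟨C, hC⟩ := hK.exists_bound_of_continuousOn hf.continuousOn
  refine Integrable.of_bound hf.aestronglyMeasurable C ?_
  filter_upwards [hν] with x hx using hC x hx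

theorem degSum_eq {n : ℕ} (m : Fin n →₀ ℕ) : degSum (fun i => m i) = m.sum fun _ e => e := by
  unfold degSum
  rw [Finsupp.sum_fintype]
  simp

theorem riesz_lift {n : ℕ} (ν : Measure (EuclideanSpace ℝ (Fin n))) [IsFiniteMeasure ν]
    (K : Set (EuclideanSpace ℝ (Fin n))) (hK : IsCompact K) (hν : ∀ᵐ x ∂ν, x ∈ K)
    (u : (Fin (n + 1) → ℕ) → ℝ) (D : ℕ)
    (hu : ∀ α : Fin n → ℕ, degSum α ≤ D → u (idxZ α 0) = ∫ x, monom α x ∂ν)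
    (p : MvPolynomial (Fin n) ℝ) (hp : p.totalDegree ≤ D) :
    riesz u (liftP p) = ∫ x, pev p x ∂ν := by
  have h1 : ∀ s : Finset (Fin n →₀ ℕ), s ⊆ p.support →
      riesz u (liftP (∑ m ∈ s, monomial m (MvPolynomial.coeff m p)))
        = ∫ x, pev (∑ m ∈ s, monomial m (MvPolynomial.coeff m p)) x ∂ν := by
    classical
    intro s
    induction s using Finset.induction_on with
    | empty => intro _; simp [liftP, riesz_zero, pev]
    | insert a s ha ih =>
      intro hs
      rw [Finset.insert_subset_iff] at hs
      rw [Finset.sum_insert ha]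
      have e1 : ∀ x, pev (monomial a (MvPolynomial.coeff a p) +
          ∑ m ∈ s, monomial m (MvPolynomial.coeff m p)) x
          = pev (monomial a (MvPolynomial.coeff a p)) x
            + pev (∑ m ∈ s, monomial m (MvPolynomial.coeff m p)) x := by
        intro x; simp only [pev, map_add]
      simp_rw [e1]
      rw [integral_add (integ ν K hK hν _ (pev_continuous _)) (integ ν K hK hν _ (pev_continuous _)),
        ← ih hs.2]
      have e2 : liftP (monomial a (MvPolynomial.coeff a p) +
          ∑ m ∈ s, monomial m (MvPolynomial.coeff m p))
          = liftP (monomial a (MvPolynomial.coeff a p))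
            + liftP (∑ m ∈ s, monomial m (MvPolynomial.coeff m p)) := by
        simp only [liftP, map_add]
      rw [e2, riesz_add]
      congr 1
      rw [liftP, rename_monomial, riesz_monomial, mapDomain_castSucc, hu]
      · simp_rw [pev_monomial]
        rw [integral_const_mul]
      · rw [degSum_eq]
        exact (le_totalDegree hs.1).trans hp
  have h2 := h1 p.support (Finset.Subset.refl _)
  rwa [← MvPolynomial.as_sum p] at h2

theorem riesz_z {n : ℕ} (u : (Fin (n + 1) → ℕ) → ℝ) (α : Fin n → ℕ) :
    riesz u (liftP (monomial (Finsupp.equivFunOnFinite.symm α) 1) * zP n) = u (idxZ α 1) := by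
  rw [liftP, rename_monomial, zP, X, monomial_mul, riesz_monomial]
  simp only [one_mul]
  congr 1
  funext i
  have h := congrFun (mapDomain_castSucc (Finsupp.equivFunOnFinite.symm α)) i
  rw [Finsupp.add_apply, h]
  refine Fin.lastCases ?_ (fun i => ?_) i
  · simp [idxZ]
  · simp [idxZ, Finsupp.single_apply, (Fin.castSucc_lt_last i).ne']

/-- Stone-Weierstrass for polynomials in several variables on a compact set -/
theorem sw {n : ℕ} (K : Set (EuclideanSpace ℝ (Fin n))) (hK : IsCompact K)
    (f : EuclideanSpace ℝ (Fin n) → ℝ) (hf : Continuous f) (ε : ℝ) (hε : 0 < ε) :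
    ∃ p : MvPolynomial (Fin n) ℝ, ∀ x ∈ K, |pev p x - f x| < ε := by
  have : CompactSpace K := isCompact_iff_compactSpace.mp hK
  let co : Fin n → C(K, ℝ) := fun i => ⟨fun x => x.1 i, by fun_prop⟩
  let φ : MvPolynomial (Fin n) ℝ →ₐ[ℝ] C(K, ℝ) := MvPolynomial.aeval co
  have hφ : ∀ p (x : K), φ p x = pev p x.1 := by
    intro p x
    induction p using MvPolynomial.induction_on with
    | C a => simp [φ, pev, _root_.algebraMap_apply]
    | add p q hp hq =>
      rw [map_add, ContinuousMap.add_apply, hp, hq]; simp [pev]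
    | mul_X p k hp =>
      rw [map_mul, ContinuousMap.mul_apply, hp]; simp [pev, φ, co]
  have hsep : φ.range.SeparatesPoints := by
    intro x y hxy
    have : ∃ i, x.1 i ≠ y.1 i := by
      by_contra hne
      push Not at hne
      exact hxy (Subtype.ext (PiLp.ext hne))
    obtain ⟨i, hi⟩ := this
    refine ⟨co i, ⟨co i, ⟨X i, by simp [φ]⟩, rfl⟩, hi⟩
  obtain ⟨⟨q, ⟨p, hp⟩⟩, hq⟩ :=
    ContinuousMap.exists_mem_subalgebra_near_continuous_of_separatesPoints φ.range hsep
      (fun x : K => f x.1) (by fun_prop) ε hε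
  refine ⟨p, fun x hx => ?_⟩
  have h1 := hq ⟨x, hx⟩
  have h2 := hφ p ⟨x, hx⟩
  have h3 : q ⟨x, hx⟩ = pev p x := by
    rw [← h2]
    exact (congrArg (fun r : C(K, ℝ) => r ⟨x, hx⟩) hp).symm
  rw [← h3]
  exact h1

/-! ### Part 3: convergence of feasible sequences -/

/-- `‖∇g‖²` as a polynomial -/
def gradSqP {n : ℕ} (p : MvPolynomial (Fin n) ℝ) : MvPolynomial (Fin n) ℝ :=
  ∑ i, pderiv i p ^ 2

theorem pev_gradSqP {n : ℕ} (p : MvPolynomial (Fin n) ℝ) (x : EuclideanSpace ℝ (Fin n)) :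
    pev (gradSqP p) x = gradSq p x := by
  simp [gradSqP, gradSq, pev]

theorem gradSq_continuous {n : ℕ} (p : MvPolynomial (Fin n) ℝ) : Continuous (gradSq p) := by
  have : gradSq p = pev (gradSqP p) := by funext x; rw [pev_gradSqP]
  rw [this]; exact pev_continuous _

theorem gradNorm_continuous {n : ℕ} (p : MvPolynomial (Fin n) ℝ) : Continuous (gradNorm p) :=
  Real.continuous_sqrt.comp (gradSq_continuous p)

theorem gradNorm_sq {n : ℕ} (p : MvPolynomial (Fin n) ℝ) (x : EuclideanSpace ℝ (Fin n)) :
    gradNorm p x ^ 2 = gradSq p x :=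
  Real.sq_sqrt (Finset.sum_nonneg fun _ _ => sq_nonneg _)

theorem thetaP_eq {n : ℕ} (p : MvPolynomial (Fin n) ℝ) :
    thetaP p = zP n ^ 2 - liftP (gradSqP p) := by
  simp [thetaP, gradSqP, liftP]

theorem core_bound {n : ℕ} (p : MvPolynomial (Fin n) ℝ) (τ : ℝ) (ℓ : ℕ)
    (ν : Measure (EuclideanSpace ℝ (Fin n))) [IsFiniteMeasure ν]
    (K : Set (EuclideanSpace ℝ (Fin n))) (hK : IsCompact K) (hν : ∀ᵐ x ∂ν, x ∈ K)
    (s : MvPolynomial (Fin n) ℝ) (c : ℝ) (hc : 0 < c) :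
    ∀ᶠ d : ℕ in atTop, ∀ u : (Fin (n + 1) → ℕ) → ℝ,
      FeasSDP2 (thetaP p) τ ℓ (fun α => ∫ x, monom α x ∂ν) d u →
      c ^ 2 * riesz u ((zP n - liftP (s ^ 2 + C c)) ^ 2)
        ≤ ∫ x, (gradSq p x - (pev s x ^ 2 + c) ^ 2) ^ 2 ∂ν := by
  set Q := liftP (s ^ 2 + C c) with hQ
  set S := liftP s with hS
  set H := liftP (gradSqP p) with hH
  set z := zP n with hz
  have hQS : Q = S ^ 2 + C c := by simp [hQ, hS, liftP]
  set R := z - Q with hR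
  set w := z ^ 2 + H - 2 * Q ^ 2 with hw
  set E := (gradSqP p - (s ^ 2 + C c) ^ 2) ^ 2 with hE
  have hEl : liftP E = (H - Q ^ 2) ^ 2 := by simp [hE, hH, hQ, liftP]
  filter_upwards [eventually_ge_atTop (w.totalDegree + ℓ), eventually_ge_atTop (R.totalDegree + 1),
    eventually_ge_atTop ((S * R).totalDegree + 1), eventually_ge_atTop ((z * R).totalDegree),
    eventually_ge_atTop ((S ^ 2 * R).totalDegree), eventually_ge_atTop E.totalDegree]
    with d h1 h2 h3 h4 h5 h6 u hu
  obtain ⟨-, huv, hpsd, hzero, -, hzpsd⟩ := hu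
  have e1 : riesz u (thetaP p * (w * 1)) = 0 :=
    hzero w 1 (by omega) (by simp)
  have e2 : riesz u (liftP E) = ∫ x, pev E x ∂ν :=
    riesz_lift ν K hK hν u (2 * d) huv E (by omega)
  have f1 := hpsd (z * R) h4
  have f2 := hpsd (S * R) (by omega)
  have f3 := hpsd (S ^ 2 * R) h5
  have f4 := hzpsd (S * R) (by omega)
  have f5 := hzpsd R (by omega)
  have id1 : thetaP p * (w * 1) + liftP E =
      (z * R) ^ 2 + C 2 * (z * (S * R) ^ 2) + C (2 * c) * (z * R ^ 2) + C (c ^ 2) * R ^ 2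
        + C (2 * c) * (S * R) ^ 2 + (S ^ 2 * R) ^ 2 := by
    rw [hEl, thetaP_eq, hw, hR, hQS]
    simp only [map_mul, map_pow]
    rw [show (C 2 : MvPolynomial (Fin (n+1)) ℝ) = 2 from map_ofNat C 2]
    ring
  have id2 := congrArg (riesz u) id1
  simp only [riesz_add, riesz_C_mul] at id2
  rw [e1, e2] at id2
  have e3 : ∀ x, pev E x = (gradSq p x - (pev s x ^ 2 + c) ^ 2) ^ 2 := by
    intro x
    rw [← pev_gradSqP]
    simp [hE, pev]
  simp_rw [e3] at id2
  have g1 : 0 ≤ 2 * c * riesz u (z * R ^ 2) := mul_nonneg (mul_nonneg zero_le_two hc.le) f5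
  have g2 : 0 ≤ 2 * c * riesz u ((S * R) ^ 2) := mul_nonneg (mul_nonneg zero_le_two hc.le) f2
  linarith

theorem conv {n : ℕ} (p : MvPolynomial (Fin n) ℝ) (τ : ℝ) (ℓ d₀ : ℕ)
    (ν : Measure (EuclideanSpace ℝ (Fin n))) [IsFiniteMeasure ν]
    (K : Set (EuclideanSpace ℝ (Fin n))) (hK : IsCompact K) (hν : ∀ᵐ x ∂ν, x ∈ K)
    (hG : ∀ x ∈ K, gradNorm p x ≠ 0) (U : ℕ → (Fin (n + 1) → ℕ) → ℝ)
    (hU : ∀ d, d₀ ≤ d → FeasSDP2 (thetaP p) τ ℓ (fun α => ∫ x, monom α x ∂ν) d (U d))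
    (α : Fin n → ℕ) :
    Tendsto (fun d => U d (idxZ α 1)) atTop (𝓝 (∫ x, monom α x * gradNorm p x ∂ν)) := by
  -- lower and upper bounds for the gradient norm
  obtain ⟨c, hc, hcK⟩ : ∃ c : ℝ, 0 < c ∧ ∀ x ∈ K, c ≤ gradNorm p x := by
    rcases K.eq_empty_or_nonempty with h | h
    · exact ⟨1, one_pos, by simp [h]⟩
    · obtain ⟨x₀, hx₀, hmin⟩ := hK.exists_isMinOn h (gradNorm_continuous p).continuousOn
      exact ⟨gradNorm p x₀, lt_of_le_of_ne (Real.sqrt_nonneg _) (hG x₀ hx₀).symm,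
        fun x hx => hmin hx⟩
  obtain ⟨B, hB⟩ := hK.exists_bound_of_continuousOn (gradNorm_continuous p).continuousOn
  obtain ⟨B₂, hB₂⟩ := hK.exists_bound_of_continuousOn
    (f := fun x => Real.sqrt (gradNorm p x - c))
    (Real.continuous_sqrt.comp ((gradNorm_continuous p).sub continuous_const)).continuousOn
  set V : ℝ := ν.real Set.univ with hV
  have hV0 : 0 ≤ V := measureReal_nonneg
  set A : ℝ := ∫ x, monom α x ^ 2 ∂ν with hA
  have hA0 : 0 ≤ A := integral_nonneg fun x => sq_nonneg _
  set M : ℝ := ∫ x, |monom α x| ∂ν with hM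
  have hM0 : 0 ≤ M := integral_nonneg fun x => abs_nonneg _
  set B' := max B 0 with hB'
  have hB'0 : 0 ≤ B' := le_max_right _ _
  set B₂' := max B₂ 0 with hB₂'
  have hB₂'0 : 0 ≤ B₂' := le_max_right _ _
  set T : ℝ := Real.sqrt (A * ((2 * B' + 1) ^ 2 * V / c ^ 2)) with hT
  have hT0 : 0 ≤ T := Real.sqrt_nonneg _
  -- main estimate
  have main : ∀ δ : ℝ, 0 < δ → δ ≤ 1 → ∀ᶠ d in atTop,
      |U d (idxZ α 1) - ∫ x, monom α x * gradNorm p x ∂ν| ≤ δ * (T + M) := by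
    intro δ hδ hδ1
    -- the approximating polynomial
    obtain ⟨s, hs⟩ : ∃ s : MvPolynomial (Fin n) ℝ, ∀ x ∈ K,
        |gradNorm p x - (pev s x ^ 2 + c)| ≤ δ := by
      set η := δ / (2 * B₂' + 1) with hη
      have hη0 : 0 < η := by positivity
      have hη1 : η ≤ 1 := by
        rw [hη, div_le_one (by positivity)]; linarith
      obtain ⟨s, hs⟩ := sw K hK (fun x => Real.sqrt (gradNorm p x - c))
        (Real.continuous_sqrt.comp ((gradNorm_continuous p).sub continuous_const)) η hη0
      refine ⟨s, fun x hx => ?_⟩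
      have h1 := (hs x hx).le
      set f := Real.sqrt (gradNorm p x - c) with hf
      have hff : f ^ 2 = gradNorm p x - c := Real.sq_sqrt (by linarith [hcK x hx])
      have hfB : |f| ≤ B₂' := (hB₂ x hx).trans (le_max_left _ _)
      have e : gradNorm p x - (pev s x ^ 2 + c) = -((pev s x - f) * (pev s x - f + 2 * f)) := by
        have : gradNorm p x = f ^ 2 + c := by linarith
        rw [this]; ring
      rw [e, abs_neg, abs_mul]
      have h2 : |pev s x - f + 2 * f| ≤ 2 * B₂' + 1 := by
        refine (abs_add_le _ _).trans ?_
        rw [abs_mul, abs_two]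
        linarith
      calc |pev s x - f| * |pev s x - f + 2 * f| ≤ η * (2 * B₂' + 1) :=
            mul_le_mul h1 h2 (abs_nonneg _) hη0.le
        _ = δ := by rw [hη]; field_simp
    set a := monomial (Finsupp.equivFunOnFinite.symm α) (1 : ℝ) with ha
    have hpa : ∀ x, pev a x = monom α x := by
      intro x; rw [ha, pev_monomial]; simp
    set q := s ^ 2 + C c with hq
    have hpq : ∀ x, pev q x = pev s x ^ 2 + c := by
      intro x; simp [hq, pev]
    filter_upwards [core_bound p τ ℓ ν K hK hν s c hc, eventually_ge_atTop d₀,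
      eventually_ge_atTop (liftP a).totalDegree, eventually_ge_atTop (zP n - liftP q).totalDegree,
      eventually_ge_atTop (a ^ 2).totalDegree, eventually_ge_atTop (a * q).totalDegree]
      with d hcore hd h3 h4 h5 h6
    have hF := hU d hd
    have hcb := hcore (U d) hF
    obtain ⟨-, huv, hpsd, -, -, -⟩ := hF
    set R := zP n - liftP q with hR
    have hintg : ∫ x, (gradSq p x - (pev s x ^ 2 + c) ^ 2) ^ 2 ∂ν ≤ (δ * (2 * B' + 1)) ^ 2 * V := by
      have : ∫ x, (gradSq p x - (pev s x ^ 2 + c) ^ 2) ^ 2 ∂ν ≤ ∫ x, (δ * (2 * B' + 1)) ^ 2 ∂ν := by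
        refine integral_mono_ae (integ ν K hK hν _ ?_) (integrable_const _) ?_
        · exact ((gradSq_continuous p).sub
            (((pev_continuous s).pow 2).add continuous_const |>.pow 2)).pow 2
        · filter_upwards [hν] with x hx
          have h1 := hs x hx
          have h2 : |gradNorm p x| ≤ B' := (hB x hx).trans (le_max_left _ _)
          set t := gradNorm p x - (pev s x ^ 2 + c) with ht
          have e : gradSq p x - (pev s x ^ 2 + c) ^ 2 = t * (2 * gradNorm p x - t) := by
            rw [← gradNorm_sq, ht]; ring
          rw [e]
          apply sq_le_sq'
          · have := neg_abs_le (t * (2 * gradNorm p x - t))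
            refine le_trans (neg_le_neg ?_) this
            rw [abs_mul]
            refine mul_le_mul h1 ?_ (abs_nonneg _) hδ.le
            refine (abs_sub _ _).trans ?_
            rw [abs_mul, abs_two]; linarith
          · refine (le_abs_self _).trans ?_
            rw [abs_mul]
            refine mul_le_mul h1 ?_ (abs_nonneg _) hδ.le
            refine (abs_sub _ _).trans ?_
            rw [abs_mul, abs_two]; linarith
      refine this.trans (le_of_eq ?_)
      rw [integral_const, smul_eq_mul, mul_comm]
    have hR2 : riesz (U d) (R ^ 2) ≤ δ ^ 2 * ((2 * B' + 1) ^ 2 * V / c ^ 2) := by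
      have hc2 : 0 < c ^ 2 := by positivity
      have : riesz (U d) (R ^ 2) ≤ ((δ * (2 * B' + 1)) ^ 2 * V) / c ^ 2 := by
        rw [le_div_iff₀ hc2]; linarith
      refine this.trans (le_of_eq ?_)
      ring
    have hcs := riesz_cs (U d) d hpsd (liftP a) R h3 h4
    have ha2 : riesz (U d) (liftP a ^ 2) = A := by
      have : liftP a ^ 2 = liftP (a ^ 2) := by simp [liftP]
      rw [this, riesz_lift ν K hK hν (U d) (2 * d) huv (a ^ 2) (by omega), hA]
      refine integral_congr_ae (Eventually.of_forall fun x => ?_)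
      simp only [← hpa]
      simp [pev]
    have hb1 : |riesz (U d) (liftP a * R)| ≤ δ * T := by
      have h7 : riesz (U d) (liftP a * R) ^ 2 ≤ δ ^ 2 * (A * ((2 * B' + 1) ^ 2 * V / c ^ 2)) := by
        rw [ha2] at hcs
        refine hcs.trans ((mul_le_mul_of_nonneg_left hR2 hA0).trans (le_of_eq ?_))
        ring
      have h8 := Real.abs_le_sqrt h7
      rwa [Real.sqrt_mul (sq_nonneg _), Real.sqrt_sq hδ.le] at h8
    have haq : riesz (U d) (liftP (a * q)) = ∫ x, monom α x * (pev s x ^ 2 + c) ∂ν := by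
      rw [riesz_lift ν K hK hν (U d) (2 * d) huv (a * q) (by omega)]
      refine integral_congr_ae (Eventually.of_forall fun x => ?_)
      simp only [← hpa, ← hpq]
      simp [pev]
    have hz := riesz_z (U d) α
    have hsplit : liftP a * zP n = liftP a * R + liftP (a * q) := by
      have : liftP (a * q) = liftP a * liftP q := by simp [liftP]
      rw [this, hR]; ring
    rw [← ha, hsplit, riesz_add, haq] at hz
    have cm := monom_continuous α
    have hsub : ∫ x, monom α x * (pev s x ^ 2 + c) ∂ν - ∫ x, monom α x * gradNorm p x ∂ν
        = ∫ x, monom α x * (pev s x ^ 2 + c - gradNorm p x) ∂ν := by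
      rw [← integral_sub]
      · refine integral_congr_ae (Eventually.of_forall fun x => ?_)
        simp only
        ring
      · exact integ ν K hK hν _ (cm.mul (((pev_continuous s).pow 2).add continuous_const))
      · exact integ ν K hK hν _ (cm.mul (gradNorm_continuous p))
    have hb2 : |∫ x, monom α x * (pev s x ^ 2 + c - gradNorm p x) ∂ν| ≤ δ * M := by
      rw [hM, ← integral_const_mul]
      refine (abs_integral_le_integral_abs).trans ?_
      refine integral_mono_ae (integ ν K hK hν _ ?_) (integ ν K hK hν _ ?_) ?_
      · exact (cm.mul ((((pev_continuous s).pow 2).add continuous_const).sub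
          (gradNorm_continuous p))).abs
      · exact continuous_const.mul cm.abs
      · filter_upwards [hν] with x hx
        rw [abs_mul, mul_comm]
        refine mul_le_mul_of_nonneg_right ?_ (abs_nonneg _)
        rw [abs_sub_comm]
        exact hs x hx
    have : U d (idxZ α 1) - ∫ x, monom α x * gradNorm p x ∂ν
        = riesz (U d) (liftP a * R) + ∫ x, monom α x * (pev s x ^ 2 + c - gradNorm p x) ∂ν := by
      rw [← hsub, ← hz]; ring
    rw [this]
    refine (abs_add_le _ _).trans ?_
    linarith
  rw [Metric.tendsto_atTop']
  intro ε hε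
  have hden : 0 < T + M + 1 := by positivity
  have hδ : 0 < min 1 (ε / 2 / (T + M + 1)) := lt_min one_pos (by positivity)
  have h1 := main _ hδ (min_le_left _ _)
  obtain ⟨N, hN⟩ := eventually_atTop.mp h1
  refine ⟨N, fun d hd => ?_⟩
  rw [Real.dist_eq]
  refine lt_of_le_of_lt (hN d hd.le) ?_
  calc min 1 (ε / 2 / (T + M + 1)) * (T + M) ≤ (ε / 2 / (T + M + 1)) * (T + M + 1) :=
        mul_le_mul (min_le_right _ _) (by linarith) (by positivity) (by positivity)
    _ = ε / 2 := by field_simp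
    _ < ε := by linarith

/-! ### Part 4: monotonicity -/

theorem totalDegree_pderiv_le' {n : ℕ} (p : MvPolynomial (Fin n) ℝ) (i : Fin n) :
    (pderiv i p).totalDegree ≤ p.totalDegree - 1 := by
  conv_lhs => rw [MvPolynomial.as_sum p, map_sum]
  refine totalDegree_finsetSum_le fun m hm => ?_
  rw [pderiv_monomial]
  by_cases h : m i = 0
  · simp [h]
  · refine (totalDegree_monomial_le _ _).trans ?_
    have h1 : m = (m - Finsupp.single i 1) + Finsupp.single i 1 := by
      ext l
      by_cases hl : l = i
      · subst hl; simp; omega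
      · simp [Finsupp.single_apply, Ne.symm hl]
    have h2 := le_totalDegree hm
    rw [h1, Finsupp.sum_add_index' (fun _ => rfl) (fun _ _ _ => rfl)] at h2
    simp only [Finsupp.sum_single_index] at h2
    exact Nat.le_sub_of_add_le h2

theorem totalDegree_gradSqP_le {n : ℕ} (p : MvPolynomial (Fin n) ℝ) :
    (gradSqP p).totalDegree ≤ 2 * (p.totalDegree - 1) := by
  refine totalDegree_finsetSum_le fun i _ => ?_
  exact (totalDegree_pow _ _).trans (Nat.mul_le_mul_left 2 (totalDegree_pderiv_le' p i))

theorem totalDegree_thetaP_le {n : ℕ} (p : MvPolynomial (Fin n) ℝ) (h : 1 ≤ p.totalDegree - 1) :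
    (thetaP p).totalDegree ≤ 2 * (p.totalDegree - 1) := by
  rw [thetaP_eq]
  refine (totalDegree_sub _ _).trans (max_le ?_ ?_)
  · refine (totalDegree_pow _ _).trans ?_
    simp only [zP, totalDegree_X]
    omega
  · exact (totalDegree_rename_le _ _).trans (totalDegree_gradSqP_le p)

theorem riesz_trunc {n : ℕ} (u : (Fin n → ℕ) → ℝ) (D : ℕ) (p : MvPolynomial (Fin n) ℝ)
    (hp : p.totalDegree ≤ D) :
    riesz (fun γ => if degSum γ ≤ D then u γ else 0) p = riesz u p := by
  unfold riesz
  refine Finset.sum_congr rfl fun m hm => ?_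
  have : degSum (fun i => m i) ≤ D := by
    rw [degSum_eq]; exact (le_totalDegree hm).trans hp
  simp only [if_pos this]

theorem degSum_idxZ {n : ℕ} (α : Fin n → ℕ) (k : ℕ) : degSum (idxZ α k) = degSum α + k := by
  unfold degSum idxZ
  rw [Fin.sum_univ_castSucc]
  simp

theorem feas_trunc {n : ℕ} (θ : MvPolynomial (Fin (n + 1)) ℝ) (τ : ℝ) (ℓ : ℕ)
    (v : (Fin n → ℕ) → ℝ) (d₁ d₂ : ℕ) (u : (Fin (n + 1) → ℕ) → ℝ) (h1 : 1 ≤ d₁) (hl : ℓ ≤ d₁)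
    (h12 : d₁ ≤ d₂) (hθ : θ.totalDegree ≤ 2 * ℓ) (hu : FeasSDP2 θ τ ℓ v d₂ u) :
    FeasSDP2 θ τ ℓ v d₁ (fun γ => if degSum γ ≤ 2 * d₁ then u γ else 0) := by
  obtain ⟨-, a2, a3, a4, a5, a6⟩ := hu
  refine ⟨fun γ hγ => if_neg (by omega), fun α hα => ?_, fun p hp => ?_, fun p q hp hq => ?_,
    fun p hp => ?_, fun p hp => ?_⟩
  · simp only
    rw [if_pos (by rw [degSum_idxZ]; omega), a2 α (by omega)]
  · rw [riesz_trunc]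
    · exact a3 p (by omega)
    · exact (totalDegree_pow _ _).trans (by omega)
  · rw [riesz_trunc]
    · exact a4 p q (by omega) (by omega)
    · have e1 := totalDegree_mul θ (p * q)
      have e2 := totalDegree_mul p q
      omega
  · rw [riesz_trunc]
    · exact a5 p (by omega)
    · have e1 := totalDegree_mul (C τ - zP n ^ 2) (p ^ 2)
      have e2 := totalDegree_pow p 2
      have e3 : (C τ - zP n ^ 2).totalDegree ≤ 2 := by
        refine (totalDegree_sub _ _).trans (max_le (by simp) ?_)
        refine (totalDegree_pow _ _).trans ?_
        simp [zP]
      omega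
  · rw [riesz_trunc]
    · exact a6 p (by omega)
    · have e1 := totalDegree_mul (zP n) (p ^ 2)
      have e2 := totalDegree_pow p 2
      have e3 : (zP n).totalDegree ≤ 1 := by simp [zP]
      omega

theorem riesz_zpow {n : ℕ} (u : (Fin (n + 1) → ℕ) → ℝ) (k : ℕ) :
    riesz u (zP n ^ k) = u (idxZ (fun _ => 0) k) := by
  rw [zP, X_pow_eq_monomial, riesz_monomial, one_mul]
  congr 1
  funext i
  refine Fin.lastCases ?_ (fun i => ?_) i
  · simp [idxZ]
  · simp [idxZ]

/-- the degenerate case of an affine (or constant) polynomial -/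
theorem zero_case {n : ℕ} (p : MvPolynomial (Fin n) ℝ) (τ : ℝ) (hp : p.totalDegree - 1 = 0)
    (v : (Fin n → ℕ) → ℝ) (d : ℕ) (hd : 1 ≤ d) (u : (Fin (n + 1) → ℕ) → ℝ)
    (hv : v (fun _ => 0) = 0 ∨ ∃ x, gradSq p x ≠ 0)
    (hu : FeasSDP2 (thetaP p) τ (p.totalDegree - 1) v d u) : u (idxZ (fun _ => 0) 1) = 0 := by
  obtain ⟨a1, a2, a3, a4, -, -⟩ := hu
  have e0 : u (idxZ (fun _ => 0) 0) = v (fun _ => 0) := a2 _ (by simp [degSum])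
  have h0 : u (idxZ (fun _ => 0) 0) = 0 := by
    rcases hv with hv | ⟨x, hx⟩
    · rw [e0, hv]
    · have hdeg : (gradSqP p).totalDegree = 0 := by
        have := totalDegree_gradSqP_le p
        omega
      rw [totalDegree_eq_zero_iff_eq_C] at hdeg
      set c := MvPolynomial.coeff 0 (gradSqP p) with hc
      have hc0 : c ≠ 0 := by
        intro h
        apply hx
        rw [← pev_gradSqP, hdeg, h]
        simp [pev]
      have hθ : thetaP p = zP n ^ 2 - C c := by
        rw [thetaP_eq, hdeg]; simp [liftP]
      have hstep : ∀ i ≤ d, u (idxZ (fun _ => 0) (2 * i + 2)) = c * u (idxZ (fun _ => 0) (2 * i)) := by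
        intro i hi
        have hdz : (zP n ^ i).totalDegree ≤ d - (p.totalDegree - 1) := by
          rw [hp]
          refine (totalDegree_pow _ _).trans ?_
          simp only [zP, totalDegree_X]
          omega
        have := a4 (zP n ^ i) (zP n ^ i) hdz hdz
        have e : thetaP p * (zP n ^ i * zP n ^ i) = zP n ^ (2 * i + 2) - C c * zP n ^ (2 * i) := by
          rw [hθ]; ring
        rw [e, riesz_sub, riesz_C_mul, riesz_zpow, riesz_zpow] at this
        linarith
      have hall : ∀ k ≤ d + 1, u (idxZ (fun _ => 0) (2 * (d + 1 - k))) = 0 := by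
        intro k
        induction k with
        | zero =>
          intro _
          apply a1
          rw [degSum_idxZ]
          omega
        | succ k ih =>
          intro hk
          have h1 := ih (by omega)
          have h2 := hstep (d - k) (by omega)
          have e1 : 2 * (d + 1 - k) = 2 * (d - k) + 2 := by omega
          have e2 : d + 1 - (k + 1) = d - k := by omega
          rw [e1, h2] at h1
          rw [e2]
          exact (mul_eq_zero.mp h1).resolve_left hc0
      have := hall (d + 1) le_rfl
      simpa using this
  have hcs := riesz_cs u d a3 (zP n ^ 0) (zP n ^ 1) (by simp) (by simpa [zP] using hd)
  rw [← pow_mul, ← pow_add, riesz_zpow, riesz_zpow, show 0 * 2 = 0 from rfl, h0, zero_mul] at hcs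
  have := sq_nonneg (u (idxZ (fun _ => 0) (0 + 1)))
  exact pow_eq_zero_iff (two_ne_zero) |>.mp (le_antisymm hcs this)

theorem mono_key {n : ℕ} (p : MvPolynomial (Fin n) ℝ) (τ : ℝ)
    (v : (Fin n → ℕ) → ℝ) (d₁ d₂ : ℕ) (h1 : 1 ≤ d₁) (hl : p.totalDegree - 1 ≤ d₁) (h12 : d₁ ≤ d₂)
    (hv : v (fun _ => 0) = 0 ∨ ∃ x, gradSq p x ≠ 0) (u u₁ : (Fin (n + 1) → ℕ) → ℝ)
    (hu : FeasSDP2 (thetaP p) τ (p.totalDegree - 1) v d₂ u)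
    (hu₁ : FeasSDP2 (thetaP p) τ (p.totalDegree - 1) v d₁ u₁) :
    ∃ u', FeasSDP2 (thetaP p) τ (p.totalDegree - 1) v d₁ u' ∧
      u' (idxZ (fun _ => 0) 1) = u (idxZ (fun _ => 0) 1) := by
  by_cases h : p.totalDegree - 1 = 0
  · refine ⟨u₁, hu₁, ?_⟩
    rw [zero_case p τ h v d₁ h1 u₁ hv hu₁, zero_case p τ h v d₂ (h1.trans h12) u hv hu]
  · refine ⟨_, feas_trunc _ τ _ v d₁ d₂ u h1 hl h12 (totalDegree_thetaP_le p (by omega)) hu, ?_⟩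
    rw [if_pos]
    rw [degSum_idxZ]
    simp [degSum]
    omega

/-! ### Part 5: the measures -/

theorem OmJp_meas {n m : ℕ} (g : Fin m → MvPolynomial (Fin n) ℝ) (b : Fin m → ℝ) (j : Fin m)
    (hcomp : IsCompact (Om g b)) :
    MeasurableSet (OmJ g b j) ∧ MeasurableSet (OmJp g b j) ∧ MeasurableSet (OmJm g b j) := by
  have h := (OmJ_isCompact g b j hcomp).isClosed.measurableSet
  have hc : Continuous (xGrad (g j)) := by
    unfold xGrad
    refine continuous_finsetSum _ fun i _ => Continuous.mul (by fun_prop) (pev_continuous _)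
  refine ⟨h, ?_, ?_⟩
  · exact h.inter (isClosed_le continuous_const hc).measurableSet
  · exact h.inter (isOpen_lt hc continuous_const).measurableSet

theorem phiJ_finite {n m : ℕ} (g : Fin m → MvPolynomial (Fin n) ℝ) (b : Fin m → ℝ) (j : Fin m)
    (hcomp : IsCompact (Om g b)) (hgrad : ∀ x ∈ OmJ g b j, gradNorm (g j) x ≠ 0) :
    IsFiniteMeasure (phiJ g b j) := by
  have hK := OmJ_isCompact g b j hcomp
  have hfin := OmJ_finite g b j hcomp hgrad
  have : IsFiniteMeasure (sigmaJ g b j) := ⟨by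
    rw [sigmaJ, Measure.restrict_apply_univ]; exact hfin⟩
  have hco : ContinuousOn (fun x => (gradNorm (g j) x)⁻¹) (OmJ g b j) :=
    (gradNorm_continuous _).continuousOn.inv₀ hgrad
  obtain ⟨B, hB⟩ := hK.exists_bound_of_continuousOn hco
  refine isFiniteMeasure_withDensity (ne_of_lt ?_)
  have hae : ∀ᵐ x ∂(sigmaJ g b j), x ∈ OmJ g b j := ae_restrict_mem hK.isClosed.measurableSet
  calc ∫⁻ x, ENNReal.ofReal (gradNorm (g j) x)⁻¹ ∂(sigmaJ g b j)
      ≤ ∫⁻ x, ENNReal.ofReal B ∂(sigmaJ g b j) := by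
        refine lintegral_mono_ae ?_
        filter_upwards [hae] with x hx
        exact ENNReal.ofReal_le_ofReal ((le_abs_self _).trans (hB x hx))
    _ < ⊤ := by
        rw [lintegral_const]
        exact ENNReal.mul_lt_top ENNReal.ofReal_lt_top (measure_lt_top _ _)

theorem phi_integral {n m : ℕ} (g : Fin m → MvPolynomial (Fin n) ℝ) (b : Fin m → ℝ) (j : Fin m)
    (hcomp : IsCompact (Om g b)) (hgrad : ∀ x ∈ OmJ g b j, gradNorm (g j) x ≠ 0)
    (α : Fin n → ℕ) :
    ∫ x, monom α x * gradNorm (g j) x ∂(phiJp g b j)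
      + ∫ x, monom α x * gradNorm (g j) x ∂(phiJm g b j)
      = ∫ x in OmJ g b j, monom α x ∂(hsd n) := by
  have := phiJ_finite g b j hcomp hgrad
  obtain ⟨h1, h2, h3⟩ := OmJp_meas g b j hcomp
  have hK := OmJ_isCompact g b j hcomp
  have hae0 : ∀ᵐ x ∂(sigmaJ g b j), x ∈ OmJ g b j := ae_restrict_mem h1
  have hae : ∀ᵐ x ∂(phiJ g b j), x ∈ OmJ g b j :=
    (withDensity_absolutelyContinuous _ _).ae_le hae0
  have hintg : Integrable (fun x => monom α x * gradNorm (g j) x) (phiJ g b j) :=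
    integ _ _ hK hae _ ((monom_continuous α).mul (gradNorm_continuous _))
  have hdisj : Disjoint (OmJp g b j) (OmJm g b j) := by
    rw [Set.disjoint_left]
    rintro x ⟨_, hx⟩ ⟨_, hx'⟩
    linarith
  have hun : OmJp g b j ∪ OmJm g b j = OmJ g b j := by
    ext x
    constructor
    · rintro (h | h)
      · exact h.1
      · exact h.1
    · intro h
      rcases le_or_gt 0 (xGrad (g j) x) with h' | h'
      · exact Or.inl ⟨h, h'⟩
      · exact Or.inr ⟨h, h'⟩
  unfold phiJp phiJm
  rw [← setIntegral_union hdisj h3 hintg.integrableOn hintg.integrableOn, hun,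
    Measure.restrict_eq_self_of_ae_mem hae]
  unfold phiJ
  rw [integral_withDensity_eq_integral_toReal_smul]
  · unfold sigmaJ
    refine setIntegral_congr_fun h1 fun x hx => ?_
    have hpos : 0 ≤ (gradNorm (g j) x)⁻¹ := inv_nonneg.mpr (Real.sqrt_nonneg _)
    simp only [ENNReal.toReal_ofReal hpos, smul_eq_mul]
    have := hgrad x hx
    field_simp
  · exact (gradNorm_continuous (g j)).measurable.inv.ennreal_ofReal
  · exact Eventually.of_forall fun x => ENNReal.ofReal_lt_top

theorem conv_sum {n m : ℕ} (g : Fin m → MvPolynomial (Fin n) ℝ) (b : Fin m → ℝ)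
    (j : Fin m) (τ : ℝ) (ℓ d₀ : ℕ)
    (hcomp : IsCompact (Om g b)) (hgrad : ∀ x ∈ OmJ g b j, gradNorm (g j) x ≠ 0)
    (Up Um : ℕ → (Fin (n + 1) → ℕ) → ℝ)
    (hU : ∀ d, d₀ ≤ d → FeasSDP2 (thetaP (g j)) τ ℓ (phiMomP g b j) d (Up d) ∧
      FeasSDP2 (thetaP (g j)) τ ℓ (phiMomM g b j) d (Um d)) (α : Fin n → ℕ) :
    Tendsto (fun d => Up d (idxZ α 1) + Um d (idxZ α 1)) atTop
      (𝓝 (∫ x in OmJ g b j, monom α x ∂(hsd n))) := by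
  have := phiJ_finite g b j hcomp hgrad
  obtain ⟨h1, h2, h3⟩ := OmJp_meas g b j hcomp
  have hK := OmJ_isCompact g b j hcomp
  have hae0 : ∀ᵐ x ∂(sigmaJ g b j), x ∈ OmJ g b j := ae_restrict_mem h1
  have hae : ∀ᵐ x ∂(phiJ g b j), x ∈ OmJ g b j :=
    (withDensity_absolutelyContinuous _ _).ae_le hae0
  rw [← phi_integral g b j hcomp hgrad α]
  have : IsFiniteMeasure (phiJp g b j) := by unfold phiJp; infer_instance
  have : IsFiniteMeasure (phiJm g b j) := by unfold phiJm; infer_instance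
  refine Tendsto.add ?_ ?_
  · exact conv (g j) τ ℓ d₀ (phiJp g b j) _ hK (ae_restrict_of_ae hae) hgrad Up
      (fun d hd => (hU d hd).1) α
  · exact conv (g j) τ ℓ d₀ (phiJm g b j) _ hK (ae_restrict_of_ae hae) hgrad Um
      (fun d hd => (hU d hd).2) α

theorem mass_alt {n m : ℕ} (g : Fin m → MvPolynomial (Fin n) ℝ) (b : Fin m → ℝ)
    (j : Fin m) (hgrad : ∀ x ∈ OmJ g b j, gradNorm (g j) x ≠ 0) :
    (phiMomP g b j (fun _ => 0) = 0 ∨ ∃ x, gradSq (g j) x ≠ 0) ∧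
    (phiMomM g b j (fun _ => 0) = 0 ∨ ∃ x, gradSq (g j) x ≠ 0) := by
  rcases (OmJ g b j).eq_empty_or_nonempty with h | ⟨x, hx⟩
  · have : phiJ g b j = 0 := by simp [phiJ, sigmaJ, h]
    constructor <;> left
    · simp [phiMomP, phiJp, this]
    · simp [phiMomM, phiJm, this]
  · have : gradSq (g j) x ≠ 0 := by
      intro h0
      exact hgrad x hx (by simp [gradNorm, h0])
    exact ⟨Or.inr ⟨x, this⟩, Or.inr ⟨x, this⟩⟩

theorem integral_zero_idx {n m : ℕ} (g : Fin m → MvPolynomial (Fin n) ℝ) (b : Fin m → ℝ)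
    (j : Fin m) : ∫ x in OmJ g b j, monom (fun _ => 0) x ∂(hsd n) = ((hsd n) (OmJ g b j)).toReal := by
  simp [monom, Measure.real]

/-- **general case, second step.**  Fix `j`.  If `u^{+,d}` (resp. `u^{−,d}`)
are optimal solutions of the order-`d` inf-relaxations of the second step with data the
moments of `φ_j⁺` (resp. `φ_j⁻`), then `u^{+,d}_{α,1} + u^{−,d}_{α,1} → ∫_{Ω_j} x^α dσ_j`
for all `α` and `u^{+,d}_{0,1} + u^{−,d}_{0,1} ↑ σ_j(Ω_j)`; for optimal solutions of the
corresponding sup-relaxations, the same limits hold and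
`u^{+,d}_{0,1} + u^{−,d}_{0,1} ↓ σ_j(Ω_j)`. -/
theorem statement15 {n m : ℕ} (g : Fin m → MvPolynomial (Fin n) ℝ) (b : Fin m → ℝ)
    (j : Fin m) (τ : ℝ)
    (hcomp : IsCompact (Om g b))
    (hbox : Om g b ⊆ Box n)
    (hgrad : ∀ k, ∀ x ∈ OmJ g b k, gradNorm (g k) x ≠ 0)
    (hτ : ∀ x ∈ OmJ g b j, gradSq (g j) x < τ) :
    (∀ Up Um : ℕ → (Fin (n + 1) → ℕ) → ℝ,
      (∀ d : ℕ,
        max 1 (max (Finset.univ.sup fun k => ((g k).totalDegree + 1) / 2)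
          ((g j).totalDegree - 1)) ≤ d →
        IsMinSDP2 (thetaP (g j)) τ ((g j).totalDegree - 1) (phiMomP g b j) d (Up d) ∧
        IsMinSDP2 (thetaP (g j)) τ ((g j).totalDegree - 1) (phiMomM g b j) d (Um d)) →
      (∀ α : Fin n → ℕ,
        Tendsto (fun d => Up d (idxZ α 1) + Um d (idxZ α 1)) atTop
          (nhds (∫ x in OmJ g b j, monom α x ∂(hsd n)))) ∧
      (∀ d₁ d₂ : ℕ,
        max 1 (max (Finset.univ.sup fun k => ((g k).totalDegree + 1) / 2)
          ((g j).totalDegree - 1)) ≤ d₁ → d₁ ≤ d₂ →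
        Up d₁ (idxZ (fun _ => 0) 1) + Um d₁ (idxZ (fun _ => 0) 1)
          ≤ Up d₂ (idxZ (fun _ => 0) 1) + Um d₂ (idxZ (fun _ => 0) 1)) ∧
      Tendsto (fun d => Up d (idxZ (fun _ => 0) 1) + Um d (idxZ (fun _ => 0) 1)) atTop
        (nhds ((hsd n) (OmJ g b j)).toReal)) ∧
    (∀ Up Um : ℕ → (Fin (n + 1) → ℕ) → ℝ,
      (∀ d : ℕ,
        max 1 (max (Finset.univ.sup fun k => ((g k).totalDegree + 1) / 2)
          ((g j).totalDegree - 1)) ≤ d →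
        IsMaxSDP2 (thetaP (g j)) τ ((g j).totalDegree - 1) (phiMomP g b j) d (Up d) ∧
        IsMaxSDP2 (thetaP (g j)) τ ((g j).totalDegree - 1) (phiMomM g b j) d (Um d)) →
      (∀ α : Fin n → ℕ,
        Tendsto (fun d => Up d (idxZ α 1) + Um d (idxZ α 1)) atTop
          (nhds (∫ x in OmJ g b j, monom α x ∂(hsd n)))) ∧
      (∀ d₁ d₂ : ℕ,
        max 1 (max (Finset.univ.sup fun k => ((g k).totalDegree + 1) / 2)
          ((g j).totalDegree - 1)) ≤ d₁ → d₁ ≤ d₂ →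
        Up d₂ (idxZ (fun _ => 0) 1) + Um d₂ (idxZ (fun _ => 0) 1)
          ≤ Up d₁ (idxZ (fun _ => 0) 1) + Um d₁ (idxZ (fun _ => 0) 1)) ∧
      Tendsto (fun d => Up d (idxZ (fun _ => 0) 1) + Um d (idxZ (fun _ => 0) 1)) atTop
        (nhds ((hsd n) (OmJ g b j)).toReal)) := by
  have hgj := hgrad j
  obtain ⟨hvp, hvm⟩ := mass_alt g b j hgj
  refine ⟨fun Up Um hU => ?_, fun Up Um hU => ?_⟩
  · have hc := conv_sum g b j τ _ _ hcomp hgj Up Um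
      (fun d hd => ⟨(hU d hd).1.1, (hU d hd).2.1⟩)
    refine ⟨hc, fun d₁ d₂ h1 h12 => ?_, ?_⟩
    · have hd1 : 1 ≤ d₁ := (le_max_left _ _).trans h1
      have hl : (g j).totalDegree - 1 ≤ d₁ :=
        ((le_max_right _ _).trans (le_max_right _ _)).trans h1
      obtain ⟨p1, m1⟩ := hU d₁ h1
      obtain ⟨p2, m2⟩ := hU d₂ (h1.trans h12)
      obtain ⟨u, hu, eu⟩ := mono_key (g j) τ _ d₁ d₂ hd1 hl h12 hvp _ _ p2.1 p1.1
      obtain ⟨w, hw, ew⟩ := mono_key (g j) τ _ d₁ d₂ hd1 hl h12 hvm _ _ m2.1 m1.1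
      have i1 := p1.2 u hu
      have i2 := m1.2 w hw
      linarith
    · rw [← integral_zero_idx]
      exact hc _
  · have hc := conv_sum g b j τ _ _ hcomp hgj Up Um
      (fun d hd => ⟨(hU d hd).1.1, (hU d hd).2.1⟩)
    refine ⟨hc, fun d₁ d₂ h1 h12 => ?_, ?_⟩
    · have hd1 : 1 ≤ d₁ := (le_max_left _ _).trans h1
      have hl : (g j).totalDegree - 1 ≤ d₁ :=
        ((le_max_right _ _).trans (le_max_right _ _)).trans h1
      obtain ⟨p1, m1⟩ := hU d₁ h1
      obtain ⟨p2, m2⟩ := hU d₂ (h1.trans h12)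
      obtain ⟨u, hu, eu⟩ := mono_key (g j) τ _ d₁ d₂ hd1 hl h12 hvp _ _ p2.1 p1.1
      obtain ⟨w, hw, ew⟩ := mono_key (g j) τ _ d₁ d₂ hd1 hl h12 hvm _ _ m2.1 m1.1
      have i1 := p1.2 u hu
      have i2 := m1.2 w hw
      linarith
    · rw [← integral_zero_idx]
      exact hc _
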